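/- (Repetition-count corollary.) In the setting of the maximum mean absolute deviation rounding guarantee—X a nonzero real n×p matrix, R a real n×m matrix with unit-Euclidean-norm rows such that Z⋆ = R Rᵀ maximizes trace(X Xᵀ Z) over PSD matrices with unit diagonal, α⋆ = √(trace(R Rᵀ X Xᵀ)), g⁽¹⁾, …, g⁽ᴷ⁾ i.i.d. standard Gaussian vectors in ℝ^m, y⁽ᵏ⁾ = sign(R g⁽ᵏ⁾), v⁽ᵏ⁾ = Xᵀ y⁽ᵏ⁾/‖Xᵀ y⁽ᵏ⁾‖₂ (zero if Xᵀ y⁽ᵏ⁾ = 0), v⋆ maximizing ‖X v⁽ᵏ⁾‖₁ over k—let ε ∈ (0,1) and δ ∈ (0,1). If K ≥ (π/2) · log(1/δ) / (ε(2−ε)), then ‖X v⋆‖₁ > (1−ε) √(2/π) ‖X‖_{2→1} except with probability at most δ. -/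

import Mathlib

open Matrix MeasureTheory
open scoped BigOperators

/-- The ℓ1 norm of a vector: sum of absolute values of the entries. -/
def l1norm {n : ℕ} (v : Fin n → ℝ) : ℝ := ∑ i, |v i|

/-- The Euclidean (ℓ2) norm of a vector. -/
noncomputable def l2norm {p : ℕ} (u : Fin p → ℝ) : ℝ := Real.sqrt (∑ j, u j ^ 2)

/-- The ℓ2 → ℓ1 operator norm of a matrix. -/
noncomputable def norm2to1 {n p : ℕ} (X : Matrix (Fin n) (Fin p) ℝ) : ℝ :=
  sSup {t : ℝ | ∃ u : Fin p → ℝ, l2norm u ≤ 1 ∧ t = l1norm (X.mulVec u)}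

/-- The sign of a real number: `1` if `0 ≤ t` and `-1` otherwise. -/
noncomputable def sgn (t : ℝ) : ℝ := if 0 ≤ t then 1 else -1

/-- The joint law of `K` independent standard Gaussian random vectors in ℝ^m. -/
noncomputable def stdGaussianSeq (K m : ℕ) : Measure (Fin K → Fin m → ℝ) :=
  Measure.pi fun _ : Fin K => Measure.pi fun _ : Fin m => ProbabilityTheory.gaussianReal 0 1

open ProbabilityTheory in
/-- The first absolute moment of the standard Gaussian distribution. -/
lemma integral_abs_gaussianReal_zero_one :
    ∫ x, |x| ∂gaussianReal 0 1 = Real.sqrt (2 / Real.pi) := by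
  rw [integral_gaussianReal_eq_integral_smul one_ne_zero]
  have h := integral_rpow_mul_exp_neg_mul_rpow (p := 2) (q := 1) (b := 1 / 2)
    (by norm_num) (by norm_num) (by norm_num)
  set f : ℝ → ℝ := fun t => (Real.sqrt (2 * Real.pi))⁻¹ *
    (t ^ (1 : ℝ) * Real.exp (-(1 / 2) * t ^ (2 : ℝ))) with hf
  have h1 : ∀ x : ℝ, gaussianPDFReal 0 1 x • |x| = f |x| := by
    intro x
    simp only [hf, gaussianPDFReal, smul_eq_mul, Real.rpow_one, Real.rpow_two, sq_abs]
    norm_num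
    ring_nf
  rw [integral_congr_ae (ae_of_all _ h1), integral_comp_abs (f := f), hf, integral_const_mul, h]
  norm_num [Real.rpow_neg_one]
  have : Real.sqrt Real.pi ≠ 0 := by positivity
  field_simp
  norm_num

section

open ProbabilityTheory

variable {ι : Type*} [Fintype ι]

/-- The standard Gaussian measure on `ι → ℝ`. -/
noncomputable abbrev piGaussian (ι : Type*) [Fintype ι] : Measure (ι → ℝ) :=
  Measure.pi fun _ : ι => gaussianReal 0 1

lemma hasGaussianLaw_id_piGaussian : HasGaussianLaw (fun g : ι → ℝ => g) (piGaussian ι) :=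
  iIndepFun.hasGaussianLaw (X := fun i (g : ι → ℝ) => g i)
    (fun i => HasLaw.hasGaussianLaw (μ := gaussianReal 0 1)
      ⟨(measurable_pi_apply i).aemeasurable, (measurePreserving_eval _ i).map_eq⟩)
    (iIndepFun_pi (X := fun _ x => x) fun _ => aemeasurable_id)

/-- The linear form `g ↦ ⟨a, g⟩` as a continuous linear map. -/
noncomputable def dotProductCLM (a : ι → ℝ) : (ι → ℝ) →L[ℝ] ℝ :=
  ∑ i, a i • ContinuousLinearMap.proj i

lemma dotProductCLM_apply (a g : ι → ℝ) : dotProductCLM a g = a ⬝ᵥ g := by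
  simp [dotProductCLM, dotProduct]

lemma hasGaussianLaw_dotProduct_prod (a b : ι → ℝ) :
    HasGaussianLaw (fun g : ι → ℝ => (a ⬝ᵥ g, b ⬝ᵥ g)) (piGaussian ι) := by
  simpa [dotProductCLM_apply] using
    hasGaussianLaw_id_piGaussian.map_fun ((dotProductCLM a).prod (dotProductCLM b))

lemma memLp_dotProduct (a : ι → ℝ) : MemLp (fun g : ι → ℝ => a ⬝ᵥ g) 2 (piGaussian ι) :=
  (hasGaussianLaw_dotProduct_prod a a).fst.memLp_two

lemma memLp_eval_piGaussian (i : ι) : MemLp (fun g : ι → ℝ => g i) 2 (piGaussian ι) := by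
  classical
  simpa using memLp_dotProduct (Pi.single i (1 : ℝ))

lemma integral_eval_piGaussian (i : ι) : ∫ g, g i ∂piGaussian ι = 0 := by
  have h := (measurePreserving_eval (fun _ : ι => gaussianReal 0 1) i).map_eq
  have := integral_map (μ := piGaussian ι) (φ := Function.eval i) (f := fun x : ℝ => x)
    (measurable_pi_apply i).aemeasurable (by fun_prop)
  rw [h, integral_id_gaussianReal] at this
  exact this.symm

lemma integral_dotProduct (a : ι → ℝ) : ∫ g, a ⬝ᵥ g ∂piGaussian ι = 0 := by
  simp only [dotProduct]
  rw [integral_finsetSum _ fun i _ =>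
    ((memLp_eval_piGaussian i).integrable (by norm_num)).const_mul _]
  simp [integral_const_mul, integral_eval_piGaussian]

lemma covariance_eval_piGaussian [DecidableEq ι] (i j : ι) :
    cov[fun g => g i, fun g => g j; piGaussian ι] = if i = j then 1 else 0 := by
  split_ifs with h
  · subst h
    rw [covariance_self (measurable_pi_apply i).aemeasurable]
    have h := (measurePreserving_eval (fun _ : ι => gaussianReal 0 1) i).map_eq
    have h2 := variance_map (μ := piGaussian ι) (Y := Function.eval i) (X := fun x : ℝ => x)
      (by fun_prop) (measurable_pi_apply i).aemeasurable
    rw [h, variance_fun_id_gaussianReal] at h2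
    simpa using! h2.symm
  · exact ((iIndepFun_pi (μ := fun _ : ι => gaussianReal 0 1) (X := fun _ x => x)
      fun _ => aemeasurable_id).indepFun h).covariance_eq_zero
        (memLp_eval_piGaussian i) (memLp_eval_piGaussian j)

lemma covariance_dotProduct (a b : ι → ℝ) :
    cov[fun g => a ⬝ᵥ g, fun g => b ⬝ᵥ g; piGaussian ι] = a ⬝ᵥ b := by
  classical
  simp only [dotProduct]
  rw [covariance_fun_sum_fun_sum (fun i => (memLp_eval_piGaussian i).const_mul _)
    (fun i => (memLp_eval_piGaussian i).const_mul _)]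
  simp [covariance_const_mul_left, covariance_const_mul_right, covariance_eval_piGaussian,
    mul_comm]

lemma integral_dotProduct_mul_dotProduct (a b : ι → ℝ) :
    ∫ g, (a ⬝ᵥ g) * (b ⬝ᵥ g) ∂piGaussian ι = a ⬝ᵥ b := by
  have h := covariance_eq_sub (memLp_dotProduct a) (memLp_dotProduct b)
  rw [covariance_dotProduct, integral_dotProduct] at h
  simpa using h.symm

lemma measurable_sgn : Measurable sgn :=
  Measurable.ite measurableSet_Ici measurable_const measurable_const

lemma abs_sgn (t : ℝ) : |sgn t| = 1 := by
  unfold sgn; split_ifs <;> simp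

lemma sgn_mul_self (t : ℝ) : sgn t * t = |t| := by
  unfold sgn
  split_ifs with h
  · simp [abs_of_nonneg h]
  · simp [abs_of_neg (not_le.1 h)]

lemma measurable_sgn_dotProduct (a : ι → ℝ) : Measurable fun g : ι → ℝ => sgn (a ⬝ᵥ g) := by
  refine measurable_sgn.comp ?_
  unfold dotProduct
  fun_prop

lemma integral_abs_dotProduct {a : ι → ℝ} (ha : a ⬝ᵥ a = 1) :
    ∫ g, |a ⬝ᵥ g| ∂piGaussian ι = Real.sqrt (2 / Real.pi) := by
  have hG := (hasGaussianLaw_dotProduct_prod a a).fst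
  have h := hG.map_eq_gaussianReal
  rw [integral_dotProduct, ← covariance_self hG.aemeasurable, covariance_dotProduct, ha] at h
  rw [← integral_abs_gaussianReal_zero_one]
  simp only [Real.toNNReal_one] at h
  rw [← h, integral_map hG.aemeasurable (by fun_prop)]

lemma memLp_sgn_dotProduct (a : ι → ℝ) :
    MemLp (fun g : ι → ℝ => sgn (a ⬝ᵥ g)) 2 (piGaussian ι) :=
  MemLp.of_bound (measurable_sgn_dotProduct a).aestronglyMeasurable 1
    (ae_of_all _ fun _ => (abs_sgn _).le)

lemma integrable_sgn_dotProduct_mul (a b : ι → ℝ) :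
    Integrable (fun g => sgn (a ⬝ᵥ g) * (b ⬝ᵥ g)) (piGaussian ι) :=
  (memLp_sgn_dotProduct a).integrable_mul (memLp_dotProduct b)

/-- The correlation between the sign of one Gaussian linear form and another linear form. -/
lemma integral_sgn_dotProduct_mul {a : ι → ℝ} (ha : a ⬝ᵥ a = 1) (b : ι → ℝ) :
    ∫ g, sgn (a ⬝ᵥ g) * (b ⬝ᵥ g) ∂piGaussian ι = Real.sqrt (2 / Real.pi) * (a ⬝ᵥ b) := by
  set c := b - (a ⬝ᵥ b) • a with hc
  have hac : a ⬝ᵥ c = 0 := by simp [hc, ha]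
  have hind : IndepFun (fun g => a ⬝ᵥ g) (fun g => c ⬝ᵥ g) (piGaussian ι) :=
    (hasGaussianLaw_dotProduct_prod a c).indepFun_of_covariance_eq_zero
      (by rw [covariance_dotProduct, hac])
  have hzero : ∫ g, sgn (a ⬝ᵥ g) * (c ⬝ᵥ g) ∂piGaussian ι = 0 := by
    have h := (hind.comp measurable_sgn measurable_id).integral_fun_mul_eq_mul_integral
      (memLp_sgn_dotProduct a).aestronglyMeasurable (memLp_dotProduct c).aestronglyMeasurable
    simpa [integral_dotProduct] using h
  have hsplit : ∀ g : ι → ℝ, sgn (a ⬝ᵥ g) * (b ⬝ᵥ g) =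
      (a ⬝ᵥ b) * |a ⬝ᵥ g| + sgn (a ⬝ᵥ g) * (c ⬝ᵥ g) := by
    intro g
    rw [← sgn_mul_self, hc, sub_dotProduct, smul_dotProduct, smul_eq_mul]
    ring
  simp_rw [hsplit]
  rw [integral_add _ (integrable_sgn_dotProduct_mul a c), hzero, integral_const_mul,
    integral_abs_dotProduct ha, add_zero, mul_comm]
  exact ((memLp_dotProduct a).integrable (by norm_num)).abs.const_mul _

/-- Rietz's lower bound for sign rounding of Gaussian projections along a fixed direction. -/
lemma two_div_pi_mul_le_integral_sq {κ : Type*} [Fintype κ] {R : Matrix κ ι ℝ}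
    (hR : ∀ i, R i ⬝ᵥ R i = 1) (x : κ → ℝ) :
    2 / Real.pi * ((x ᵥ* R) ⬝ᵥ (x ᵥ* R)) ≤
      ∫ g, (∑ i, x i * sgn ((R *ᵥ g) i)) ^ 2 ∂piGaussian ι := by
  set s := Real.sqrt (2 / Real.pi) with hs
  have hs2 : s ^ 2 = 2 / Real.pi := Real.sq_sqrt (by positivity)
  set w := x ᵥ* R with hw
  set Y : (ι → ℝ) → ℝ := fun g => ∑ i, x i * sgn (R i ⬝ᵥ g) with hY
  have hYL : MemLp Y 2 (piGaussian ι) :=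
    memLp_finsetSum _ fun i _ => (memLp_sgn_dotProduct (R i)).const_mul (x i)
  have hwL := memLp_dotProduct w
  have hcross : ∫ g, Y g * (w ⬝ᵥ g) ∂piGaussian ι = s * (w ⬝ᵥ w) := by
    simp_rw [hY, Finset.sum_mul, mul_assoc]
    rw [integral_finsetSum _ fun i _ => (integrable_sgn_dotProduct_mul (R i) w).const_mul _]
    simp_rw [integral_const_mul, integral_sgn_dotProduct_mul (hR _)]
    rw [← hs]
    have : w ⬝ᵥ w = ∑ i, x i * (R i ⬝ᵥ w) := by
      conv_lhs => rw [hw, ← dotProduct_mulVec]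
      rfl
    rw [this, Finset.mul_sum]
    exact Finset.sum_congr rfl fun i _ => by ring
  have hnn : 0 ≤ ∫ g, (Y g - s * (w ⬝ᵥ g)) ^ 2 ∂piGaussian ι :=
    integral_nonneg fun g => sq_nonneg _
  have hexp : ∀ g, (Y g - s * (w ⬝ᵥ g)) ^ 2 =
      Y g ^ 2 - 2 * s * (Y g * (w ⬝ᵥ g)) + s ^ 2 * ((w ⬝ᵥ g) * (w ⬝ᵥ g)) := fun g => by ring
  have hi1 := hYL.integrable_sq
  have hi2 := (hYL.integrable_mul hwL).const_mul (2 * s)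
  have hi3 := (hwL.integrable_mul hwL).const_mul (s ^ 2)
  simp only [Pi.mul_apply] at hi2 hi3
  simp_rw [hexp] at hnn
  rw [integral_add (f := fun g => Y g ^ 2 - 2 * s * (Y g * (w ⬝ᵥ g))) (hi1.sub hi2) hi3, integral_sub hi1 hi2, integral_const_mul,
    integral_const_mul, hcross, integral_dotProduct_mul_dotProduct] at hnn
  change _ ≤ ∫ g, Y g ^ 2 ∂piGaussian ι
  rw [← hs2]
  linarith

/-- A reverse Markov inequality for a bounded nonnegative random variable. -/
lemma measureReal_le_of_le_integral {Ω : Type*} [MeasurableSpace Ω] {μ : Measure Ω}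
    [IsProbabilityMeasure μ] {T : Ω → ℝ} (hT : Measurable T) (hT0 : ∀ ω, 0 ≤ T ω) {M c r : ℝ}
    (hM : 0 < M) (hTM : ∀ ω, T ω ≤ M) (hc : 0 ≤ c) (hr : 0 ≤ r) (hint : c * M ≤ ∫ ω, T ω ∂μ) :
    μ.real {ω | T ω ≤ r * c * M} ≤ 1 - c * (1 - r) := by
  set A := {ω | T ω ≤ r * c * M} with hA
  have hAm : MeasurableSet A := measurableSet_le hT measurable_const
  have hTi : Integrable T μ := Integrable.of_bound hT.aestronglyMeasurable M
    (ae_of_all _ fun ω => by rw [Real.norm_of_nonneg (hT0 ω)]; exact hTM ω)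
  have hle : ∀ ω, T ω ≤ r * c * M + Aᶜ.indicator (fun _ => M) ω := by
    intro ω
    by_cases h : ω ∈ A
    · rw [Set.indicator_of_notMem (by simpa using h), add_zero]
      exact h
    · have : 0 ≤ r * c * M := by positivity
      simp only [Set.indicator_of_mem (Set.mem_compl h)]
      linarith [hTM ω]
  have hi : Integrable (Aᶜ.indicator fun _ : Ω => M) μ :=
    (integrable_const M).indicator hAm.compl
  have h := integral_mono hTi ((integrable_const (r * c * M)).add hi) hle
  simp only [Pi.add_apply] at h
  rw [integral_add (integrable_const _) hi, integral_indicator_const _ hAm.compl,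
    probReal_compl_eq_one_sub hAm] at h
  simp at h
  have h2 : c * M ≤ (r * c + 1 - μ.real A) * M := by linarith
  linarith [le_of_mul_le_mul_right h2 hM]

end

lemma trace_mul_transpose_mul_mul_transpose {ι κ μ : Type*} [Fintype ι] [Fintype κ] [Fintype μ]
    (X : Matrix ι κ ℝ) (R : Matrix ι μ ℝ) :
    (X * Xᵀ * (R * Rᵀ)).trace = ∑ j, (Xᵀ j ᵥ* R) ⬝ᵥ (Xᵀ j ᵥ* R) := by
  have h : (X * Xᵀ * (R * Rᵀ)).trace = ((Xᵀ * R) * (Xᵀ * R)ᵀ).trace := by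
    rw [Matrix.mul_assoc, trace_mul_comm, transpose_mul, transpose_transpose]
    simp only [Matrix.mul_assoc]
  rw [h]
  simp [trace, Matrix.mul_apply, dotProduct, vecMul, mul_comm]

lemma trace_mul_transpose_mul_vecMulVec {ι κ : Type*} [Fintype ι] [Fintype κ]
    (X : Matrix ι κ ℝ) (s : ι → ℝ) :
    (X * Xᵀ * vecMulVec s s).trace = ∑ j, (Xᵀ *ᵥ s) j ^ 2 := by
  rw [mul_vecMulVec, trace_vecMulVec, ← mulVec_mulVec, dotProduct_comm, dotProduct_mulVec,
    ← mulVec_transpose]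
  simp [dotProduct, sq]

lemma sum_mulVec_sq_le_of_trace_le {ι κ : Type*} [Fintype ι] [Fintype κ]
    {X : Matrix ι κ ℝ} {M : ℝ}
    (hM : ∀ Z : Matrix ι ι ℝ, Z.PosSemidef → (∀ i, Z i i = 1) → (X * Xᵀ * Z).trace ≤ M)
    {s : ι → ℝ} (hs : ∀ i, |s i| = 1) : ∑ j, (Xᵀ *ᵥ s) j ^ 2 ≤ M := by
  rw [← trace_mul_transpose_mul_vecMulVec]
  refine hM _ (by simpa using posSemidef_vecMulVec_self_star s) fun i => ?_
  rw [vecMulVec_apply, ← abs_mul_abs_self, hs, one_mul]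

lemma trace_mul_transpose_self_pos {ι κ : Type*} [Fintype ι] [Fintype κ]
    {X : Matrix ι κ ℝ} (hX : X ≠ 0) : 0 < (X * Xᵀ).trace := by
  have h := (posSemidef_self_mul_conjTranspose X).trace_nonneg
  have h2 := (trace_mul_conjTranspose_self_eq_zero_iff (A := X)).not.2 hX
  rw [conjTranspose_eq_transpose_of_trivial] at h h2
  exact lt_of_le_of_ne h (Ne.symm h2)

/-- A semidefinite upper bound for the squared `ℓ2 → ℓ1` norm. -/
lemma norm2to1_le_sqrt {n p : ℕ} {X : Matrix (Fin n) (Fin p) ℝ} {M : ℝ}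
    (hM : ∀ s : Fin n → ℝ, (∀ i, |s i| = 1) → ∑ j, (Xᵀ *ᵥ s) j ^ 2 ≤ M) :
    norm2to1 X ≤ Real.sqrt M := by
  refine csSup_le ⟨_, 0, by simp [l2norm], rfl⟩ ?_
  rintro _ ⟨u, hu, rfl⟩
  set s : Fin n → ℝ := fun i => sgn ((X *ᵥ u) i) with hs
  have h1 : l1norm (X *ᵥ u) = (Xᵀ *ᵥ s) ⬝ᵥ u := by
    rw [mulVec_transpose, ← dotProduct_mulVec]
    simp [l1norm, dotProduct, hs, sgn_mul_self]
  rw [h1]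
  calc (Xᵀ *ᵥ s) ⬝ᵥ u ≤ Real.sqrt (∑ j, (Xᵀ *ᵥ s) j ^ 2) * l2norm u :=
        Real.sum_mul_le_sqrt_mul_sqrt _ _ _
    _ ≤ Real.sqrt (∑ j, (Xᵀ *ᵥ s) j ^ 2) * 1 := by gcongr
    _ ≤ Real.sqrt M := by
        rw [mul_one]
        exact Real.sqrt_le_sqrt (hM s fun i => abs_sgn _)

lemma l2norm_le_l1norm_mulVec_normalize {n p : ℕ} (X : Matrix (Fin n) (Fin p) ℝ) {s : Fin n → ℝ}
    (hs : ∀ i, |s i| = 1) :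
    l2norm (Xᵀ *ᵥ s) ≤ l1norm (X *ᵥ ((l2norm (Xᵀ *ᵥ s))⁻¹ • Xᵀ *ᵥ s)) := by
  set u := Xᵀ *ᵥ s with hu
  have h1 : s ⬝ᵥ (X *ᵥ ((l2norm u)⁻¹ • u)) = l2norm u := by
    rw [dotProduct_mulVec, ← mulVec_transpose, ← hu, dotProduct_smul, smul_eq_mul]
    have h2 : u ⬝ᵥ u = l2norm u * l2norm u := by
      rw [l2norm, Real.mul_self_sqrt (Finset.sum_nonneg fun _ _ => sq_nonneg _)]
      simp [dotProduct, sq]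
    rw [h2]
    by_cases h0 : l2norm u = 0
    · simp [h0]
    · field_simp
  refine h1.symm.trans_le (Finset.sum_le_sum fun i _ => (le_abs_self _).trans ?_)
  rw [abs_mul, hs, one_mul]

/-- In one rounding trial, the failure probability is bounded away from one. -/
lemma measureReal_sum_sq_le_le {n p m : ℕ} {X : Matrix (Fin n) (Fin p) ℝ}
    {R : Matrix (Fin n) (Fin m) ℝ} (hR : ∀ i, R i ⬝ᵥ R i = 1)
    (hpos : 0 < (X * Xᵀ * (R * Rᵀ)).trace)
    (hM : ∀ s : Fin n → ℝ, (∀ i, |s i| = 1) →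
      ∑ j, (Xᵀ *ᵥ s) j ^ 2 ≤ (X * Xᵀ * (R * Rᵀ)).trace)
    {r : ℝ} (hr : 0 ≤ r) :
    (piGaussian (Fin m)).real {g | ∑ j, (Xᵀ *ᵥ fun i => sgn ((R *ᵥ g) i)) j ^ 2 ≤
      r * (2 / Real.pi) * (X * Xᵀ * (R * Rᵀ)).trace} ≤ 1 - 2 / Real.pi * (1 - r) := by
  have hYL : ∀ j, MemLp (fun g : Fin m → ℝ => ∑ i, X i j * sgn ((R *ᵥ g) i)) 2
      (piGaussian (Fin m)) := fun j =>
    memLp_finsetSum _ fun i _ => (memLp_sgn_dotProduct (R i)).const_mul (X i j)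
  have hmeas : ∀ i, Measurable fun g : Fin m → ℝ => sgn ((R *ᵥ g) i) :=
    fun i => measurable_sgn_dotProduct (R i)
  refine measureReal_le_of_le_integral ?_ (fun g => Finset.sum_nonneg fun _ _ => sq_nonneg _)
    hpos (fun g => hM _ fun i => abs_sgn _) (by positivity) hr ?_
  · refine Finset.measurable_sum _ fun j _ => Measurable.pow_const ?_ 2
    change Measurable fun g => ∑ i, X i j * sgn ((R *ᵥ g) i)
    exact Finset.measurable_sum _ fun i _ => (hmeas i).const_mul _
  · have h : ∫ g, ∑ j, (Xᵀ *ᵥ fun i => sgn ((R *ᵥ g) i)) j ^ 2 ∂piGaussian (Fin m) =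
        ∑ j, ∫ g, (∑ i, X i j * sgn ((R *ᵥ g) i)) ^ 2 ∂piGaussian (Fin m) :=
      integral_finsetSum _ fun j _ => (hYL j).integrable_sq
    rw [h, trace_mul_transpose_mul_mul_transpose, Finset.mul_sum]
    exact Finset.sum_le_sum fun j _ => two_div_pi_mul_le_integral_sq hR (Xᵀ j)

lemma one_sub_pow_le_of_log_div_le {q δ : ℝ} {K : ℕ} (hq0 : 0 < q) (hq1 : q ≤ 1) (hδ : 0 < δ)
    (hK : Real.log (1 / δ) / q ≤ K) : (1 - q) ^ K ≤ δ := by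
  rw [div_le_iff₀ hq0, one_div, Real.log_inv] at hK
  calc (1 - q) ^ K ≤ Real.exp (-q) ^ K :=
        pow_le_pow_left₀ (by linarith) (Real.one_sub_le_exp_neg q) K
    _ = Real.exp (-(K * q)) := by rw [← Real.exp_nat_mul]; ring_nf
    _ ≤ Real.exp (Real.log δ) := Real.exp_le_exp.2 (by linarith)
    _ = δ := Real.exp_log hδ

theorem mdr_repetition_count {n p m K : ℕ}
    (X : Matrix (Fin n) (Fin p) ℝ) (hX : X ≠ 0)
    (R : Matrix (Fin n) (Fin m) ℝ)
    (hrows : ∀ i, ∑ j, R i j ^ 2 = 1)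
    (hmax : ∀ Z : Matrix (Fin n) (Fin n) ℝ, Z.PosSemidef → (∀ i, Z i i = 1) →
      (X * Xᵀ * Z).trace ≤ (X * Xᵀ * (R * Rᵀ)).trace)
    (αstar : ℝ) (hα : αstar = Real.sqrt (R * Rᵀ * (X * Xᵀ)).trace)
    (y : (Fin m → ℝ) → Fin n → ℝ)
    (hy : ∀ g, y g = fun i => sgn (R.mulVec g i))
    (v : (Fin m → ℝ) → Fin p → ℝ)
    (hv : ∀ g, v g = (l2norm (Xᵀ.mulVec (y g)))⁻¹ • Xᵀ.mulVec (y g))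
    (vstar : (Fin K → Fin m → ℝ) → Fin p → ℝ)
    (hvstar : ∀ ω, (∃ k, vstar ω = v (ω k)) ∧
      ∀ k, l1norm (X.mulVec (v (ω k))) ≤ l1norm (X.mulVec (vstar ω)))
    (ε δ : ℝ) (hε : ε ∈ Set.Ioo (0 : ℝ) 1) (hδ : δ ∈ Set.Ioo (0 : ℝ) 1)
    (hKbound : (K : ℝ) ≥ Real.pi / 2 * Real.log (1 / δ) / (ε * (2 - ε))) :
    (stdGaussianSeq K m)
        {ω | ¬ (1 - ε) * Real.sqrt (2 / Real.pi) * norm2to1 X < l1norm (X.mulVec (vstar ω))} ≤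
      ENNReal.ofReal δ := by
  obtain ⟨hε0, hε1⟩ := hε
  set M := (X * Xᵀ * (R * Rᵀ)).trace
  have hR : ∀ i, R i ⬝ᵥ R i = 1 := fun i => by
    rw [← hrows i]
    simp [dotProduct, sq]
  have hM : ∀ s : Fin n → ℝ, (∀ i, |s i| = 1) → ∑ j, (Xᵀ *ᵥ s) j ^ 2 ≤ M :=
    fun s hs => sum_mulVec_sq_le_of_trace_le hmax hs
  have hMpos : 0 < M := (trace_mul_transpose_self_pos hX).trans_le <| by
    simpa using hmax 1 PosSemidef.one (by simp)
  set E := {g : Fin m → ℝ | ∑ j, (Xᵀ *ᵥ fun i => sgn ((R *ᵥ g) i)) j ^ 2 ≤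
    (1 - ε) ^ 2 * (2 / Real.pi) * M}
  have hsub : {ω | ¬ (1 - ε) * Real.sqrt (2 / Real.pi) * norm2to1 X
      < l1norm (X.mulVec (vstar ω))} ⊆ Set.pi Set.univ fun _ : Fin K => E := by
    intro ω hω k _
    have h1 : l2norm (Xᵀ *ᵥ y (ω k)) ≤ l1norm (X *ᵥ v (ω k)) := by
      rw [hv]
      exact l2norm_le_l1norm_mulVec_normalize X fun i => by rw [hy]; exact abs_sgn _
    have h2 : l2norm (Xᵀ *ᵥ y (ω k)) ≤ (1 - ε) * Real.sqrt (2 / Real.pi) * Real.sqrt M :=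
      h1.trans <| ((hvstar ω).2 k).trans <| (not_lt.1 hω).trans <|
        mul_le_mul_of_nonneg_left (norm2to1_le_sqrt hM)
          (mul_nonneg (by linarith) (Real.sqrt_nonneg _))
    have h3 := pow_le_pow_left₀ (Real.sqrt_nonneg _) h2 2
    rwa [Real.sq_sqrt (Finset.sum_nonneg fun _ _ => sq_nonneg _), mul_pow, mul_pow,
      Real.sq_sqrt (by positivity), Real.sq_sqrt hMpos.le, hy] at h3
  have hq : (piGaussian (Fin m)).real E ≤ 1 - 2 / Real.pi * (1 - (1 - ε) ^ 2) :=
    measureReal_sum_sq_le_le hR hMpos hM (sq_nonneg _)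
  have hfac : 1 - (1 - ε) ^ 2 = ε * (2 - ε) := by ring
  rw [hfac] at hq
  have hεε : 0 < ε * (2 - ε) := mul_pos hε0 (by linarith)
  calc stdGaussianSeq K m _ ≤ stdGaussianSeq K m (Set.pi Set.univ fun _ : Fin K => E) :=
        measure_mono hsub
    _ = ENNReal.ofReal ((piGaussian (Fin m)).real E ^ K) := by
        rw [stdGaussianSeq, Measure.pi_pi, Finset.prod_const, Finset.card_univ, Fintype.card_fin,
          ENNReal.ofReal_pow measureReal_nonneg, ofReal_measureReal]
    _ ≤ ENNReal.ofReal δ := by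
        refine ENNReal.ofReal_le_ofReal
          ((pow_le_pow_left₀ measureReal_nonneg hq K).trans ?_)
        refine one_sub_pow_le_of_log_div_le (by positivity) ?_ hδ.1 ?_
        · linarith [measureReal_nonneg.trans hq]
        · refine le_of_eq_of_le ?_ hKbound
          have := Real.pi_pos.ne'
          field_simp
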